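/- Label-classifier upper bound on I(Z1; Y | Z2, S): Let S, Y, Z1, Z2 be jointly distributed random variables on finite types. Let r(y | z) be any conditional probability mass function over the values of Y such that r(y | z) > 0 whenever P(Y=y, Z2=z) > 0. Then I(Z1; Y | Z2, S) ≤ −∑_{s,y,z} P(S=s, Y=y, Z2=z) · log r(y | z), where the conditioning set {Z2, S} is treated as a single random variable taking values in the product of the corresponding finite types. -/

import Mathlib

/-!
Label-classifier upper bound on I(Z1; Y | Z2, S): for any conditional pmf
`r (y | z)` positive whenever P(Y=y, Z2=z) > 0,
I(Z1; Y | Z2, S) ≤ −∑_{s,y,z} P(S=s, Y=y, Z2=z) · log r(y|z),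
where the conditioning set {Z2, S} is treated as a single (tuple-valued)
random variable.
-/

open Finset

noncomputable section

variable {S Y Z1 Z2 : Type*} [Fintype S] [Fintype Y] [Fintype Z1] [Fintype Z2]

/-- Marginal P(S = s, Z2 = z2). -/
def margSZ2 (p : S → Y → Z1 → Z2 → ℝ) (s : S) (z2 : Z2) : ℝ := ∑ y, ∑ z1, p s y z1 z2

/-- Marginal P(S = s, Y = y, Z2 = z2). -/
def margSYZ2 (p : S → Y → Z1 → Z2 → ℝ) (s : S) (y : Y) (z2 : Z2) : ℝ := ∑ z1, p s y z1 z2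

/-- Marginal P(S = s, Z1 = z1, Z2 = z2). -/
def margSZ1Z2 (p : S → Y → Z1 → Z2 → ℝ) (s : S) (z1 : Z1) (z2 : Z2) : ℝ := ∑ y, p s y z1 z2

/-- Marginal P(Y = y, Z2 = z2). -/
def margYZ2 (p : S → Y → Z1 → Z2 → ℝ) (y : Y) (z2 : Z2) : ℝ := ∑ s, ∑ z1, p s y z1 z2

/-- Conditional mutual information I(Z1; Y | Z2, S), conditioning on the tuple (Z2, S). -/
def cmiZ1Y_Z2S (p : S → Y → Z1 → Z2 → ℝ) : ℝ :=
  ∑ s, ∑ y, ∑ z1, ∑ z2, p s y z1 z2 *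
    Real.log ((p s y z1 z2 / margSZ2 p s z2) /
      ((margSZ1Z2 p s z1 z2 / margSZ2 p s z2) * (margSYZ2 p s y z2 / margSZ2 p s z2)))

/-- Pointwise estimate: since `p s y z1 z2 ≤ margSZ1Z2 p s z1 z2`, each summand of the conditional
mutual information is controlled through `log x ≤ x - 1`. -/
theorem cmi_summand_le
    (p : S → Y → Z1 → Z2 → ℝ)
    (hp_nonneg : ∀ s y z1 z2, 0 ≤ p s y z1 z2)
    (r : Z2 → Y → ℝ)
    (hr_pos : ∀ y z, 0 < margYZ2 p y z → 0 < r z y)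
    (s : S) (y : Y) (z1 : Z1) (z2 : Z2) :
    p s y z1 z2 * Real.log ((p s y z1 z2 / margSZ2 p s z2) /
      ((margSZ1Z2 p s z1 z2 / margSZ2 p s z2) * (margSYZ2 p s y z2 / margSZ2 p s z2))) ≤
    p s y z1 z2 * (r z2 y * margSZ2 p s z2 / margSYZ2 p s y z2 - 1 - Real.log (r z2 y)) := by
  rcases (hp_nonneg s y z1 z2).eq_or_lt with h0 | h0
  · simp [← h0]
  have ha : p s y z1 z2 ≤ margSZ1Z2 p s z1 z2 :=
    single_le_sum (f := fun y => p s y z1 z2) (fun y _ => hp_nonneg s y z1 z2) (mem_univ y)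
  have hb : p s y z1 z2 ≤ margSYZ2 p s y z2 :=
    single_le_sum (f := fun z1 => p s y z1 z2) (fun z1 _ => hp_nonneg s y z1 z2) (mem_univ z1)
  have hm : margSYZ2 p s y z2 ≤ margSZ2 p s z2 :=
    single_le_sum (f := fun y => margSYZ2 p s y z2)
      (fun y _ => sum_nonneg fun z1 _ => hp_nonneg s y z1 z2) (mem_univ y)
  have hq : margSYZ2 p s y z2 ≤ margYZ2 p y z2 :=
    single_le_sum (f := fun s => margSYZ2 p s y z2)
      (fun s _ => sum_nonneg fun z1 _ => hp_nonneg s y z1 z2) (mem_univ s)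
  have hr := hr_pos y z2 (h0.trans_le (hb.trans hq))
  have ha0 := h0.trans_le ha
  have hb0 := h0.trans_le hb
  have hm0 := hb0.trans_le hm
  have hlog := Real.log_le_sub_one_of_pos (div_pos (mul_pos hr hm0) hb0)
  rw [Real.log_div (by positivity) (by positivity), Real.log_mul hr.ne' hm0.ne'] at hlog
  have hpa := Real.log_le_log h0 ha
  refine mul_le_mul_of_nonneg_left ?_ h0.le
  rw [Real.log_div (by positivity) (by positivity), Real.log_mul (by positivity) (by positivity),
    Real.log_div h0.ne' hm0.ne', Real.log_div ha0.ne' hm0.ne', Real.log_div hb0.ne' hm0.ne']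
  linarith

/-- Label-classifier upper bound on I(Z1; Y | Z2, S). -/
theorem label_classifier_upper_bound
    (p : S → Y → Z1 → Z2 → ℝ)
    (hp_nonneg : ∀ s y z1 z2, 0 ≤ p s y z1 z2)
    (hp_sum : ∑ s, ∑ y, ∑ z1, ∑ z2, p s y z1 z2 = 1)
    (r : Z2 → Y → ℝ)
    (hr_nonneg : ∀ z y, 0 ≤ r z y)
    (hr_sum : ∀ z, ∑ y, r z y = 1)
    (hr_pos : ∀ y z, 0 < margYZ2 p y z → 0 < r z y) :
    cmiZ1Y_Z2S p ≤ -∑ s, ∑ y, ∑ z, margSYZ2 p s y z * Real.log (r z y) := by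
  have hpt : ∀ s y z, ∑ z1, p s y z1 z * Real.log ((p s y z1 z / margSZ2 p s z) /
      ((margSZ1Z2 p s z1 z / margSZ2 p s z) * (margSYZ2 p s y z / margSZ2 p s z))) ≤
      r z y * margSZ2 p s z - margSYZ2 p s y z - margSYZ2 p s y z * Real.log (r z y) := by
    intro s y z
    have hm : 0 ≤ margSZ2 p s z :=
      sum_nonneg fun y _ => sum_nonneg fun z1 _ => hp_nonneg s y z1 z
    have hrm := mul_nonneg (hr_nonneg z y) hm
    refine (sum_le_sum fun z1 _ => cmi_summand_le p hp_nonneg r hr_pos s y z1 z).trans ?_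
    rw [← sum_mul]
    change margSYZ2 p s y z * _ ≤ _
    rcases eq_or_ne (margSYZ2 p s y z) 0 with h | h
    · simpa [h] using hrm
    · rw [mul_sub, mul_sub, mul_div_cancel₀ _ h, mul_one]
  have hzero : ∀ s z, ∑ y, (r z y * margSZ2 p s z - margSYZ2 p s y z) = 0 := by
    intro s z
    rw [sum_sub_distrib, ← sum_mul, hr_sum, one_mul]
    exact sub_self _
  rw [cmiZ1Y_Z2S, ← sum_neg_distrib]
  refine sum_le_sum fun s _ => ?_
  calc
    _ = ∑ y, ∑ z, ∑ z1, p s y z1 z * Real.log ((p s y z1 z / margSZ2 p s z) /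
      ((margSZ1Z2 p s z1 z / margSZ2 p s z) * (margSYZ2 p s y z / margSZ2 p s z))) :=
        sum_congr rfl fun y _ => sum_comm
    _ ≤ ∑ y, ∑ z, (r z y * margSZ2 p s z - margSYZ2 p s y z
          - margSYZ2 p s y z * Real.log (r z y)) :=
        sum_le_sum fun y _ => sum_le_sum fun z _ => hpt s y z
    _ = ∑ z, ∑ y, (r z y * margSZ2 p s z - margSYZ2 p s y z)
          - ∑ y, ∑ z, margSYZ2 p s y z * Real.log (r z y) := by
        rw [sum_comm (f := fun z y => r z y * margSZ2 p s z - margSYZ2 p s y z),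
          ← sum_sub_distrib]
        simp only [sum_sub_distrib]
    _ = _ := by simp [hzero]

end
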